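/- arXiv:1111.1954 — 3 statements merged into one kernel-verified Lean document; each statement's English description precedes it below -/
import Mathlib

section
/- Let n ≥ 1, let Δ ⊆ ℚ^n be a semilinear subset which is bounded below (say Δ ⊆ [γ₀, ∞)^n with γ₀ ∈ ℚ), and let m ≥ 1 be an integer. Then: (i) for every k ∈ ℤ the set {γ ∈ Δ : m·γ ∈ ℤ^n and m·w(γ) = k} is finite, and its cardinality N_k vanishes for k < m·n·γ₀; (ii) the formal Laurent series Σ_{k ∈ ℤ} N_k·V^k ∈ ℤ((V)) lies in the image of the localization of the Laurent polynomial ring ℤ[V, V^{-1}] at the multiplicative set generated by {1 − V^i : i ≥ 1}, under the ring homomorphism to ℤ((V)) induced by the inclusion ℤ[V, V^{-1}] → ℤ((V)) (each 1 − V^i being a unit of ℤ((V))). (This is the rationality statement of the paper's Lemma on bounded-below definable subsets of Γ^n, rewritten in the variable V = T^{-1}; the factor (T − 1)^n appearing there is itself invertible in this localization.) -/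
noncomputable section

/-- Semilinear subsets of `ℚ^n`: finite Boolean combinations of rational half-spaces
`{x | a₁x₁ + ⋯ + aₙxₙ ≥ c}` with `a ∈ ℤ^n` and `c ∈ ℚ`. -/
inductive Semilinear {n : ℕ} : Set (Fin n → ℚ) → Prop
  | halfspace (a : Fin n → ℤ) (c : ℚ) :
      Semilinear {x | c ≤ ∑ i, (a i : ℚ) * x i}
  | compl {s : Set (Fin n → ℚ)} : Semilinear s → Semilinear sᶜ
  | union {s t : Set (Fin n → ℚ)} : Semilinear s → Semilinear t → Semilinear (s ∪ t)
  | inter {s t : Set (Fin n → ℚ)} : Semilinear s → Semilinear t → Semilinear (s ∩ t)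

/-- The multiplicative subset of `ℤ[V, V⁻¹]` generated by `1 - V^i`, `i ≥ 1`. -/
def laurentDenoms : Submonoid (LaurentPolynomial ℤ) :=
  Submonoid.closure {q | ∃ i : ℕ, 1 ≤ i ∧ q = 1 - LaurentPolynomial.T (i : ℤ)}

/-- **Dickson's lemma**, relative to a map into a well-quasi-order: a set has a finite subset
lying below all of its elements. -/
theorem exists_finite_dominating {α β : Type*} [PartialOrder β] [WellQuasiOrderedLE β]
    (f : α → β) (S : Set α) :
    ∃ F : Set α, F.Finite ∧ F ⊆ S ∧ ∀ x ∈ S, ∃ y ∈ F, f y ≤ f x := by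
  have hfin : {b | Minimal (· ∈ f '' S) b}.Finite :=
    WellQuasiOrderedLE.finite_of_isAntichain (setOfPred_minimal_antichain _)
  rcases S.eq_empty_or_nonempty with rfl | ⟨x₀, -⟩
  · exact ⟨∅, Set.finite_empty, subset_rfl, by simp⟩
  have : Nonempty α := ⟨x₀⟩
  choose! g hgS hg using fun (b : β) (hb : b ∈ f '' S) => hb
  refine ⟨g '' {b | Minimal (· ∈ f '' S) b}, hfin.image g, ?_, fun x hx => ?_⟩
  · rintro _ ⟨b, hb, rfl⟩
    exact hgS b hb.prop
  · obtain ⟨b, hbx, hb⟩ := (Set.isPWO_of_wellQuasiOrderedLE (f '' S)).exists_le_minimal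
      (Set.mem_image_of_mem f hx)
    exact ⟨g b, ⟨b, hb, rfl⟩, (hg b hb.prop).trans_le hbx⟩

theorem indicator_sub_indicator_of_subset {α : Type*} {S S₀ U : Set α} (h₀ : S₀ ⊆ S) (hU : U ⊆ S)
    (hcover : ∀ x ∈ S, x ∉ U → x ∈ S₀) :
    S.indicator (1 : α → ℤ) - U.indicator 1 = S₀.indicator 1 - (S₀ ∩ U).indicator 1 := by
  classical
  ext x
  have h₁ := hcover x
  have h₂ := @hU x
  have h₃ := @h₀ x
  simp only [Pi.sub_apply, Set.indicator_apply, Pi.one_apply, Set.mem_inter_iff]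
  by_cases hx : x ∈ S <;> by_cases hx' : x ∈ U <;> by_cases hx₀ : x ∈ S₀ <;> simp_all

section GeneratingSeries

variable {ι : Type*}

theorem mem_piAntidiag_univ [Fintype ι] [DecidableEq ι] {y : ι → ℕ} {k : ℕ} :
    y ∈ Finset.piAntidiag Finset.univ k ↔ ∑ i, y i = k := by
  simp

/-- The generating series `∑ₖ (∑_{|y| = k} f y) Xᵏ` of a function on `ℕ^ι`. -/
def degreeSeries [Fintype ι] [DecidableEq ι] (f : (ι → ℕ) → ℤ) : PowerSeries ℤ :=
  PowerSeries.mk fun k => ∑ y ∈ Finset.piAntidiag Finset.univ k, f y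

/-- The products of polynomials `1 - X^i` with `i ≥ 1`. -/
def cyclotomicDenoms : Submonoid (Polynomial ℤ) :=
  Submonoid.closure {q | ∃ i : ℕ, 1 ≤ i ∧ q = 1 - Polynomial.X ^ i}

/-- The additive group of power series that become polynomials after multiplication by a
product of polynomials `1 - X^i`. -/
def rationalSeries : AddSubgroup (PowerSeries ℤ) where
  carrier := {p | ∃ d ∈ cyclotomicDenoms, ∃ r : Polynomial ℤ, (d : PowerSeries ℤ) * p = r}
  zero_mem' := ⟨1, one_mem _, 0, by simp⟩
  add_mem' := by
    rintro p q ⟨d, hd, r, hr⟩ ⟨e, he, s, hs⟩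
    refine ⟨d * e, mul_mem hd he, e * r + d * s, ?_⟩
    push_cast
    rw [← hr, ← hs]
    ring
  neg_mem' := by
    rintro p ⟨d, hd, r, hr⟩
    exact ⟨d, hd, -r, by push_cast; rw [← hr]; ring⟩

theorem mem_rationalSeries_of_sub_mul_mem {p : PowerSeries ℤ} {i : ℕ} (hi : 1 ≤ i)
    (h : p - PowerSeries.X ^ i * p ∈ rationalSeries) : p ∈ rationalSeries := by
  obtain ⟨d, hd, r, hr⟩ := h
  refine ⟨d * (1 - Polynomial.X ^ i),
    mul_mem hd (Submonoid.subset_closure ⟨i, hi, rfl⟩), r, ?_⟩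
  rw [← hr]
  push_cast
  ring

theorem degreeSeries_sub [Fintype ι] [DecidableEq ι] (f g : (ι → ℕ) → ℤ) :
    degreeSeries (f - g) = degreeSeries f - degreeSeries g := by
  ext k
  simp [degreeSeries]

theorem degreeSeries_translate [Fintype ι] [DecidableEq ι] (g : ι → ℕ) (S : Set (ι → ℕ)) :
    degreeSeries (((g + ·) '' S).indicator 1) =
      PowerSeries.X ^ (∑ i, g i) * degreeSeries (S.indicator 1) := by
  ext k
  classical
  rw [PowerSeries.coeff_X_pow_mul']
  simp only [degreeSeries, PowerSeries.coeff_mk, Set.indicator_apply, Pi.one_apply,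
    ← Finset.sum_filter]
  split_ifs with hk
  · symm
    refine Finset.sum_nbij (g + ·) ?_ ?_ ?_ ?_
    · intro y hy
      simp only [Finset.mem_filter, mem_piAntidiag_univ] at hy ⊢
      refine ⟨?_, y, hy.2, rfl⟩
      simp only [Pi.add_apply, Finset.sum_add_distrib, hy.1]
      omega
    · exact (add_right_injective g).injOn
    · rintro _ hx
      simp only [Finset.coe_filter, mem_piAntidiag_univ, Set.mem_ofPred_eq] at hx
      obtain ⟨hx, y, hy, rfl⟩ := hx
      refine ⟨y, ?_, rfl⟩
      simp only [Finset.coe_filter, mem_piAntidiag_univ, Set.mem_ofPred_eq]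
      simp only [Pi.add_apply, Finset.sum_add_distrib] at hx
      exact ⟨by omega, hy⟩
    · simp
  · refine Finset.sum_eq_zero fun x hx => ?_
    simp only [Finset.mem_filter, mem_piAntidiag_univ] at hx
    obtain ⟨hx, y, hy, rfl⟩ := hx
    simp only [Pi.add_apply, Finset.sum_add_distrib] at hx
    omega

theorem degreeSeries_mem_of_finite [Fintype ι] [DecidableEq ι] {A : Set (ι → ℕ)} (hA : A.Finite) :
    degreeSeries (A.indicator 1) ∈ rationalSeries := by
  refine ⟨1, one_mem _, ∑ y ∈ hA.toFinset, Polynomial.X ^ (∑ i, y i), ?_⟩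
  classical
  ext k
  simp only [degreeSeries, Polynomial.coe_one, one_mul, PowerSeries.coeff_mk,
    Polynomial.coeff_coe, Polynomial.finsetSum_coeff, Polynomial.coeff_X_pow,
    Set.indicator_apply, Pi.one_apply, ← Finset.sum_filter]
  refine Finset.sum_congr ?_ fun _ _ => rfl
  ext y
  simp [and_comm, eq_comm]

/-- The union of the translates of the monoid generated by `G` by the elements of `A`. -/
def translatesClosure (A : Set (ι → ℕ)) (G : Finset (ι → ℕ)) : Set (ι → ℕ) :=
  {x | ∃ a ∈ A, ∃ h ∈ AddSubmonoid.closure (G : Set (ι → ℕ)), a + h = x}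

/-- Noetherianity for monomial modules. -/
theorem exists_finite_translatesClosure_eq {A : Set (ι → ℕ)} (hA : A.Finite)
    (G : Finset (ι → ℕ)) {T : Set (ι → ℕ)} (hT : T ⊆ translatesClosure A G)
    (hadd : ∀ x ∈ T, ∀ h ∈ AddSubmonoid.closure (G : Set (ι → ℕ)), x + h ∈ T) :
    ∃ B : Set (ι → ℕ), B.Finite ∧ T = translatesClosure B G := by
  have key (a : ι → ℕ) := exists_finite_dominating
    (fun (u : (ι → ℕ) → ℕ) (g : G) => u g) {u | a + ∑ g ∈ G, u g • g ∈ T}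
  choose F hF hFS hdom using key
  refine ⟨⋃ a ∈ A, (fun u => a + ∑ g ∈ G, u g • g) '' F a,
    hA.biUnion fun a _ => (hF a).image _, ?_⟩
  ext x
  constructor
  · intro hx
    obtain ⟨a, ha, h, hh, rfl⟩ := hT hx
    obtain ⟨u, -, rfl⟩ := AddSubmonoid.mem_closure_finset.1 hh
    obtain ⟨v, hv, hvu⟩ := hdom a u hx
    refine ⟨a + ∑ g ∈ G, v g • g, ?_, ∑ g ∈ G, (u g - v g) • g, ?_, ?_⟩
    · simp only [Set.mem_iUnion]
      exact ⟨a, ha, v, hv, rfl⟩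
    · exact sum_mem fun g hg => nsmul_mem (AddSubmonoid.subset_closure hg) _
    · rw [add_assoc, ← Finset.sum_add_distrib]
      congr 1
      refine Finset.sum_congr rfl fun g hg => ?_
      rw [← add_nsmul, Nat.add_sub_cancel' (hvu ⟨g, hg⟩)]
  · rintro ⟨b, hb, h, hh, rfl⟩
    simp only [Set.mem_iUnion] at hb
    obtain ⟨a, -, u, hu, rfl⟩ := hb
    exact hadd _ (hFS a hu) _ hh

theorem degreeSeries_translatesClosure_mem [Fintype ι] [DecidableEq ι] (G : Finset (ι → ℕ)) (hG : ∀ g ∈ G, g ≠ 0) :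
    ∀ A : Set (ι → ℕ), A.Finite →
      degreeSeries ((translatesClosure A G).indicator 1) ∈ rationalSeries := by
  induction G using Finset.induction_on with
  | empty =>
    intro A hA
    have : translatesClosure A ∅ = A := by ext; simp [translatesClosure]
    rw [this]
    exact degreeSeries_mem_of_finite hA
  | insert g G hg ih =>
    specialize ih fun x hx => hG x (Finset.mem_insert_of_mem hx)
    intro A hA
    set S := translatesClosure A (insert g G) with hS
    set S₀ := translatesClosure A G with hS₀
    have hle : AddSubmonoid.closure (G : Set (ι → ℕ)) ≤
        AddSubmonoid.closure ((insert g G : Finset _) : Set (ι → ℕ)) :=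
      AddSubmonoid.closure_mono (by simp)
    have hgmem : g ∈ AddSubmonoid.closure ((insert g G : Finset _) : Set (ι → ℕ)) :=
      AddSubmonoid.subset_closure (by simp)
    have hS₀S : S₀ ⊆ S := by
      rintro _ ⟨a, ha, h, hh, rfl⟩
      exact ⟨a, ha, h, hle hh, rfl⟩
    have hgS : (g + ·) '' S ⊆ S := by
      rintro _ ⟨_, ⟨a, ha, h, hh, rfl⟩, rfl⟩
      exact ⟨a, ha, g + h, add_mem hgmem hh, by ac_rfl⟩
    have hcover : ∀ x ∈ S, x ∉ (g + ·) '' S → x ∈ S₀ := by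
      rintro _ ⟨a, ha, h, hh, rfl⟩ hx
      rw [Finset.coe_insert, Set.insert_eq, AddSubmonoid.closure_union,
        AddSubmonoid.mem_sup] at hh
      obtain ⟨y, hy, z, hz, rfl⟩ := hh
      obtain ⟨k, rfl⟩ := AddSubmonoid.mem_closure_singleton.1 hy
      cases k with
      | zero => exact ⟨a, ha, z, hz, by simp⟩
      | succ k =>
        refine absurd ⟨a + (k • g + z), ⟨a, ha, _,
          add_mem (nsmul_mem hgmem k) (hle hz), rfl⟩, ?_⟩ hx
        simp only [succ_nsmul]
        ac_rfl
    obtain ⟨B, hB, hBeq⟩ := exists_finite_translatesClosure_eq hA G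
      (T := S₀ ∩ (g + ·) '' S) Set.inter_subset_left (by
        rintro _ ⟨⟨a, ha, h, hh, rfl⟩, ⟨_, ⟨b, hb, h', hh', rfl⟩, hx⟩⟩ k hk
        refine ⟨⟨a, ha, h + k, add_mem hh hk, by ac_rfl⟩,
          b + (h' + k), ⟨b, hb, _, add_mem hh' (hle hk), rfl⟩, ?_⟩
        rw [← hx]
        simp only
        ac_rfl)
    have hdiff : S.indicator (1 : (ι → ℕ) → ℤ) - ((g + ·) '' S).indicator 1 =
        S₀.indicator 1 - (S₀ ∩ (g + ·) '' S).indicator 1 :=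
      indicator_sub_indicator_of_subset hS₀S hgS hcover
    refine mem_rationalSeries_of_sub_mul_mem (i := ∑ i, g i) ?_ ?_
    · obtain ⟨i, hi⟩ := Function.ne_iff.1 (hG g (Finset.mem_insert_self _ _))
      exact (Nat.one_le_iff_ne_zero.2 hi).trans
        (Finset.single_le_sum (f := g) (fun _ _ => Nat.zero_le _) (Finset.mem_univ i))
    · rw [← degreeSeries_translate, ← degreeSeries_sub, hdiff, degreeSeries_sub, hBeq]
      exact sub_mem (ih A hA) (ih B hB)

/-- The points of `ℕ^ι` satisfying the inequalities `c ≤ ∑ aᵢ zᵢ` for all `(a, c) ∈ J`. -/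
def latticePolyhedron [Fintype ι] (J : Finset ((ι → ℤ) × ℤ)) : Set (ι → ℕ) :=
  {z | ∀ p ∈ J, p.2 ≤ ∑ i, p.1 i * (z i : ℤ)}

theorem sum_mul_sub_cast [Fintype ι] {a : ι → ℤ} {y z : ι → ℕ} (h : y ≤ z) :
    ∑ i, a i * ((z - y : ι → ℕ) i : ℤ) = ∑ i, a i * (z i : ℤ) - ∑ i, a i * (y i : ℤ) := by
  rw [← Finset.sum_sub_distrib]
  refine Finset.sum_congr rfl fun i _ => ?_
  rw [Pi.sub_apply, Nat.cast_sub (h i)]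
  ring

theorem sum_mul_add_cast [Fintype ι] (a : ι → ℤ) (y z : ι → ℕ) :
    ∑ i, a i * ((y + z : ι → ℕ) i : ℤ) = ∑ i, a i * (y i : ℤ) + ∑ i, a i * (z i : ℤ) := by
  simp [mul_add, Finset.sum_add_distrib]

/-- Every subset of a polyhedron has a finite subset from which all its elements are obtained by
adding recession directions. -/
theorem exists_finite_dominating_polyhedron [Fintype ι] (J : Finset ((ι → ℤ) × ℤ)) {S : Set (ι → ℕ)}
    (hS : S ⊆ latticePolyhedron J) :
    ∃ F : Set (ι → ℕ), F.Finite ∧ F ⊆ S ∧ ∀ x ∈ S, ∃ y ∈ F, y ≤ x ∧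
      ∀ p ∈ J, 0 ≤ ∑ i, p.1 i * ((x - y : ι → ℕ) i : ℤ) := by
  obtain ⟨F, hF, hFS, hdom⟩ := exists_finite_dominating
    (fun (z : ι → ℕ) => (z, fun p : J => (∑ i, p.1.1 i * (z i : ℤ) - p.1.2).toNat)) S
  refine ⟨F, hF, hFS, fun x hx => ?_⟩
  obtain ⟨y, hy, hyx, hyx'⟩ := hdom x hx
  refine ⟨y, hy, hyx, fun p hp => ?_⟩
  have h₁ := hyx' ⟨p, hp⟩
  have h₂ := hS hx p hp
  have h₃ := hS (hFS hy) p hp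
  rw [sum_mul_sub_cast hyx]
  dsimp only at h₁ ⊢
  omega

/-- **Gordan's lemma** for the lattice points of a rational cone in the positive orthant. -/
theorem exists_closure_eq_cone [Fintype ι] [DecidableEq ι] (J : Finset ((ι → ℤ) × ℤ)) :
    ∃ G : Finset (ι → ℕ), (∀ g ∈ G, g ≠ 0) ∧
      ∀ z : ι → ℕ, z ∈ AddSubmonoid.closure (G : Set (ι → ℕ)) ↔
        ∀ p ∈ J, 0 ≤ ∑ i, p.1 i * (z i : ℤ) := by
  obtain ⟨F, hF, hFS, hdom⟩ := exists_finite_dominating_polyhedron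
    (J.image fun p => (p.1, 0))
    (S := {z | z ≠ 0 ∧ ∀ p ∈ J, 0 ≤ ∑ i, p.1 i * (z i : ℤ)}) (by
      rintro z ⟨-, hz⟩
      intro p hp
      obtain ⟨q, hq, rfl⟩ := Finset.mem_image.1 hp
      exact hz q hq)
  refine ⟨hF.toFinset, fun g hg => (hFS (hF.mem_toFinset.1 hg)).1, fun z => ⟨fun hz => ?_, ?_⟩⟩
  · induction hz using AddSubmonoid.closure_induction with
    | mem x hx => exact (hFS (hF.mem_toFinset.1 hx)).2
    | zero => simp
    | add x y _ _ hx hy =>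
      intro p hp
      rw [sum_mul_add_cast]
      exact add_nonneg (hx p hp) (hy p hp)
  · induction hk : ∑ i, z i using Nat.strong_induction_on generalizing z with
    | _ k ih =>
      intro hz
      by_cases hz₀ : z = 0
      · rw [hz₀]
        exact zero_mem _
      obtain ⟨y, hy, hyz, hpos⟩ := hdom z ⟨hz₀, hz⟩
      have hsplit : z - y + y = z := tsub_add_cancel_of_le hyz
      have hlt : ∑ i, (z - y) i < k := by
        have hsum : ∑ i, (z - y) i + ∑ i, y i = k := by
          rw [← Finset.sum_add_distrib, ← hk]
          exact Finset.sum_congr rfl fun i _ => congrFun hsplit i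
        obtain ⟨i, hi⟩ := Function.ne_iff.1 (hFS hy).1
        have := Finset.single_le_sum (f := y) (fun _ _ => Nat.zero_le _) (Finset.mem_univ i)
        have : y i ≠ 0 := hi
        omega
      rw [← hsplit]
      refine add_mem (ih _ hlt _ rfl fun p hp => ?_)
        (AddSubmonoid.subset_closure (hF.mem_toFinset.2 hy))
      exact hpos (p.1, 0) (Finset.mem_image_of_mem _ hp)

theorem degreeSeries_polyhedron_mem [Fintype ι] [DecidableEq ι] (J : Finset ((ι → ℤ) × ℤ)) :
    degreeSeries ((latticePolyhedron J).indicator 1) ∈ rationalSeries := by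
  obtain ⟨G, hG, hcone⟩ := exists_closure_eq_cone J
  obtain ⟨F, hF, hFS, hdom⟩ := exists_finite_dominating_polyhedron J
    (S := latticePolyhedron J) subset_rfl
  have : latticePolyhedron J = translatesClosure F G := by
    ext x
    constructor
    · intro hx
      obtain ⟨y, hy, hyx, hpos⟩ := hdom x hx
      exact ⟨y, hy, x - y, (hcone _).2 hpos, add_tsub_cancel_of_le hyx⟩
    · rintro ⟨a, ha, h, hh, rfl⟩ p hp
      rw [sum_mul_add_cast]
      exact le_add_of_le_of_nonneg (hFS ha p hp) ((hcone h).1 hh p hp)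
  rw [this]
  exact degreeSeries_translatesClosure_mem G hG F hF

/-- The ring of functions on `ℕ^ι` generated by the indicators of integral half-spaces. -/
def polyhedralFunctions (ι : Type*) [Fintype ι] : Subring ((ι → ℕ) → ℤ) :=
  Subring.closure {f | ∃ (a : ι → ℤ) (c : ℤ),
    f = {z : ι → ℕ | c ≤ ∑ i, a i * (z i : ℤ)}.indicator 1}

theorem degreeSeries_mem_of_polyhedral [Fintype ι] [DecidableEq ι] {f : (ι → ℕ) → ℤ} (hf : f ∈ polyhedralFunctions ι) :
    degreeSeries f ∈ rationalSeries := by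
  rw [polyhedralFunctions, Subring.mem_closure_iff] at hf
  induction hf using AddSubgroup.closure_induction with
  | mem f hf =>
    suffices ∃ J, f = (latticePolyhedron J).indicator 1 by
      obtain ⟨J, rfl⟩ := this
      exact degreeSeries_polyhedron_mem J
    induction hf using Submonoid.closure_induction with
    | mem f hf =>
      obtain ⟨a, c, rfl⟩ := hf
      exact ⟨{(a, c)}, by simp [latticePolyhedron]⟩
    | one => exact ⟨∅, by simp [latticePolyhedron]⟩
    | mul f g _ _ hf hg =>
      classical
      obtain ⟨J, rfl⟩ := hf
      obtain ⟨K, rfl⟩ := hg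
      refine ⟨J ∪ K, ?_⟩
      have hJK : latticePolyhedron (J ∪ K) = latticePolyhedron J ∩ latticePolyhedron K := by
        ext z
        simp [latticePolyhedron, or_imp, forall_and]
      rw [hJK, Set.inter_indicator_one]
  | zero =>
    have := zero_mem rationalSeries
    convert this
    ext
    simp [degreeSeries]
  | add f g _ _ hf hg =>
    convert add_mem hf hg
    ext
    simp [degreeSeries, Finset.sum_add_distrib]
  | neg f _ hf =>
    convert neg_mem hf
    ext
    simp [degreeSeries]

end GeneratingSeries

section Semilinear

/-- The map `y ↦ (y + s) / m` identifying `ℕ^n` with the lattice points of `[s / m, ∞)^n`. -/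
def latticePoint {n : ℕ} (m : ℕ) (s : ℤ) (y : Fin n → ℕ) : Fin n → ℚ :=
  fun i => ((y i : ℚ) + s) / m

theorem latticePoint_injective {n m : ℕ} (hm : 1 ≤ m) (s : ℤ) :
    Function.Injective (latticePoint (n := n) m s) := by
  intro y z h
  ext i
  have hi := congrFun h i
  have : (m : ℚ) ≠ 0 := by positivity
  simpa [latticePoint, div_left_inj' this] using hi

theorem Semilinear.indicator_preimage_mem {n m : ℕ} (hm : 1 ≤ m) (s : ℤ) {Δ : Set (Fin n → ℚ)}
    (hΔ : Semilinear Δ) :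
    (latticePoint m s ⁻¹' Δ).indicator 1 ∈ polyhedralFunctions (Fin n) := by
  classical
  induction hΔ with
  | halfspace a c =>
    refine Subring.subset_closure ⟨a, ⌈m * c - s * ∑ i, (a i : ℚ)⌉, ?_⟩
    congr 1
    ext y
    have hm' : (0 : ℚ) < m := by positivity
    have : ∑ i, (a i : ℚ) * latticePoint m s y i =
        (∑ i, (a i : ℚ) * y i + s * ∑ i, (a i : ℚ)) / m := by
      rw [Finset.mul_sum, ← Finset.sum_add_distrib, Finset.sum_div]
      exact Finset.sum_congr rfl fun i _ => by simp only [latticePoint]; ring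
    simp only [Set.mem_preimage, Set.mem_ofPred_eq, this, Int.ceil_le, le_div_iff₀ hm']
    push_cast
    constructor <;> intro h <;> linarith
  | @compl Δ _ ih =>
    convert sub_mem (one_mem _) ih using 1
    ext y
    by_cases hy : latticePoint m s y ∈ Δ <;> simp [hy]
  | @union Δ Δ' _ _ ih ih' =>
    convert sub_mem (add_mem ih ih') (mul_mem ih ih') using 1
    ext y
    by_cases hy : latticePoint m s y ∈ Δ <;> by_cases hy' : latticePoint m s y ∈ Δ' <;>
      simp [hy, hy']
  | @inter Δ Δ' _ _ ih ih' =>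
    convert mul_mem ih ih' using 1
    ext y
    by_cases hy : latticePoint m s y ∈ Δ <;> by_cases hy' : latticePoint m s y ∈ Δ' <;>
      simp [hy, hy']

theorem toLaurent_mem_laurentDenoms {d : Polynomial ℤ} (hd : d ∈ cyclotomicDenoms) :
    Polynomial.toLaurent d ∈ laurentDenoms := by
  induction hd using Submonoid.closure_induction with
  | mem d hd =>
    obtain ⟨i, hi, rfl⟩ := hd
    exact Submonoid.subset_closure ⟨i, hi, by simp⟩
  | one => simp
  | mul d e _ _ hd he =>
    rw [map_mul]
    exact mul_mem hd he

theorem map_toLaurent_eq_ofPowerSeries {φ : LaurentPolynomial ℤ →+* LaurentSeries ℤ}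
    (hφ : ∀ i : ℤ, φ (LaurentPolynomial.T i) = HahnSeries.single i 1) (r : Polynomial ℤ) :
    φ (Polynomial.toLaurent r) = HahnSeries.ofPowerSeries ℤ ℤ r := by
  have : φ.comp (Polynomial.toLaurent (R := ℤ)) =
      (HahnSeries.ofPowerSeries ℤ ℤ).comp Polynomial.coeToPowerSeries.ringHom := by
    ext1
    · exact RingHom.ext_int _ _
    · simp [hφ]
  exact RingHom.congr_fun this r

theorem single_mul_ofPowerSeries_mem_range {p : PowerSeries ℤ} (hp : p ∈ rationalSeries) (t : ℤ)
    {φ : LaurentPolynomial ℤ →+* LaurentSeries ℤ}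
    (hφ : ∀ i : ℤ, φ (LaurentPolynomial.T i) = HahnSeries.single i 1)
    {ψ : Localization laurentDenoms →+* LaurentSeries ℤ}
    (hψ : ψ.comp (algebraMap (LaurentPolynomial ℤ) (Localization laurentDenoms)) = φ) :
    HahnSeries.single t 1 * HahnSeries.ofPowerSeries ℤ ℤ p ∈ Set.range ψ := by
  obtain ⟨d, hd, r, hr⟩ := hp
  have hψ' (x) : ψ (algebraMap _ _ x) = φ x := RingHom.congr_fun hψ x
  let D : laurentDenoms := ⟨_, toLaurent_mem_laurentDenoms hd⟩
  have hunit : IsUnit (φ (Polynomial.toLaurent d)) := by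
    rw [← hψ']
    exact (IsLocalization.map_units (Localization laurentDenoms) D).map ψ
  refine ⟨IsLocalization.mk' _ (LaurentPolynomial.T t * Polynomial.toLaurent r) D, ?_⟩
  apply hunit.mul_right_cancel
  rw [← hψ', ← map_mul]
  erw [IsLocalization.mk'_spec]
  rw [hψ', hψ', map_mul, hφ, map_toLaurent_eq_ofPowerSeries hφ, map_toLaurent_eq_ofPowerSeries hφ,
    ← hr, map_mul]
  ring

theorem setOf_lattice_eq_image {n m : ℕ} (hm : 1 ≤ m) {Δ : Set (Fin n → ℚ)} {γ₀ : ℚ}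
    (hbd : ∀ x ∈ Δ, ∀ i, γ₀ ≤ x i) (k : ℤ) :
    {γ ∈ Δ | (∀ i, ∃ z : ℤ, (m : ℚ) * γ i = z) ∧ (m : ℚ) * ∑ i, γ i = k} =
      latticePoint m ⌈m * γ₀⌉ ''
        {y | latticePoint m ⌈m * γ₀⌉ y ∈ Δ ∧ n * ⌈m * γ₀⌉ + ∑ i, (y i : ℤ) = k} := by
  set s := ⌈m * γ₀⌉
  have hm' : (m : ℚ) ≠ 0 := by positivity
  have hsum (y : Fin n → ℕ) :
      (m : ℚ) * ∑ i, latticePoint m s y i = ((n * s + ∑ i, (y i : ℤ) : ℤ) : ℚ) := by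
    simp only [latticePoint, ← Finset.sum_div, mul_div_cancel₀ _ hm', Finset.sum_add_distrib]
    simp [add_comm]
  ext γ
  constructor
  · rintro ⟨hγ, hz, hk⟩
    choose z hz using hz
    have hsz (i) : s ≤ z i := by
      rw [Int.ceil_le, ← hz i]
      exact mul_le_mul_of_nonneg_left (hbd γ hγ i) (by positivity)
    have hy : latticePoint m s (fun i => (z i - s).toNat) = γ := by
      ext i
      have : (((z i - s).toNat : ℤ) : ℚ) = z i - s := by
        rw [Int.toNat_of_nonneg (sub_nonneg.2 (hsz i))]
        push_cast
        rfl
      rw [Int.cast_natCast] at this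
      rw [latticePoint, this, sub_add_cancel, ← hz i, mul_div_cancel_left₀ _ hm']
    refine ⟨_, ⟨by rwa [hy], ?_⟩, hy⟩
    rw [← hy, hsum] at hk
    exact_mod_cast hk
  · rintro ⟨y, ⟨hy, hk⟩, rfl⟩
    refine ⟨hy, fun i => ⟨y i + s, ?_⟩, ?_⟩
    · simp only [latticePoint, mul_div_cancel₀ _ hm']
      push_cast
      rfl
    · rw [hsum, hk]

end Semilinear

/-- Let `Δ ⊆ ℚ^n` (`n ≥ 1`) be semilinear and bounded below, say `Δ ⊆ [γ₀, ∞)^n`,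
and let `m ≥ 1`.  Then (i) for every `k ∈ ℤ` the set of `γ ∈ Δ` with `m·γ ∈ ℤ^n` and
`m·w(γ) = k` is finite, and its cardinality `N_k` vanishes for `k < m·n·γ₀`;
(ii) the Laurent series `Σ_k N_k V^k ∈ ℤ((V))` lies in the image of the localization
of `ℤ[V, V⁻¹]` at the multiplicative set generated by `{1 - V^i : i ≥ 1}` under the
ring homomorphism to `ℤ((V))` induced by the inclusion `ℤ[V, V⁻¹] → ℤ((V))`. -/
theorem semilinear_generating_series_rational
    (n : ℕ) (hn : 1 ≤ n) (Δ : Set (Fin n → ℚ)) (hΔ : Semilinear Δ)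
    (γ₀ : ℚ) (hbd : ∀ x ∈ Δ, ∀ i, γ₀ ≤ x i) (m : ℕ) (hm : 1 ≤ m) :
    (∀ k : ℤ, {γ ∈ Δ | (∀ i, ∃ z : ℤ, (m : ℚ) * γ i = z) ∧
        (m : ℚ) * ∑ i, γ i = k}.Finite) ∧
    (∀ k : ℤ, (k : ℚ) < m * n * γ₀ →
      {γ ∈ Δ | (∀ i, ∃ z : ℤ, (m : ℚ) * γ i = z) ∧
        (m : ℚ) * ∑ i, γ i = k}.ncard = 0) ∧
    ∃ F : LaurentSeries ℤ,
      (∀ k : ℤ, F.coeff k =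
        ({γ ∈ Δ | (∀ i, ∃ z : ℤ, (m : ℚ) * γ i = z) ∧
          (m : ℚ) * ∑ i, γ i = k}.ncard : ℤ)) ∧
      ∀ (φ : LaurentPolynomial ℤ →+* LaurentSeries ℤ),
        (∀ i : ℤ, φ (LaurentPolynomial.T i) = HahnSeries.single i 1) →
        ∀ (ψ : Localization laurentDenoms →+* LaurentSeries ℤ),
          ψ.comp (algebraMap (LaurentPolynomial ℤ) (Localization laurentDenoms)) = φ →
          F ∈ Set.range ψ := by
  classical
  have himg := setOf_lattice_eq_image hm hbd
  set s := ⌈m * γ₀⌉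
  have hfin (k : ℤ) : {y : Fin n → ℕ | latticePoint m s y ∈ Δ ∧
      n * s + ∑ i, (y i : ℤ) = k}.Finite := by
    refine (Finset.piAntidiag Finset.univ (k - n * s).toNat).finite_toSet.subset ?_
    rintro y ⟨-, hy⟩
    rw [← Nat.cast_sum] at hy
    simp only [Finset.mem_coe, mem_piAntidiag_univ]
    omega
  refine ⟨fun k => ?_, fun k hk => ?_,
    HahnSeries.single (n * s) 1 * HahnSeries.ofPowerSeries ℤ ℤ
      (degreeSeries ((latticePoint m s ⁻¹' Δ).indicator 1)), fun k => ?_, ?_⟩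
  · rw [himg]
    exact (hfin k).image _
  · refine (Set.ncard_eq_zero (by rw [himg]; exact (hfin k).image _)).2 ?_
    refine Set.eq_empty_iff_forall_notMem.2 ?_
    rintro γ ⟨hγ, -, hγk⟩
    have : n * γ₀ ≤ ∑ i, γ i := by
      simpa using Finset.card_nsmul_le_sum Finset.univ γ γ₀ fun i _ => hbd γ hγ i
    have := mul_le_mul_of_nonneg_left this (Nat.cast_nonneg (α := ℚ) m)
    rw [hγk] at this
    linarith
  · rw [himg, Set.ncard_image_of_injective _ (latticePoint_injective hm _),
      show k = (k - n * s) + n * s by ring, HahnSeries.coeff_single_mul_add, one_mul,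
      PowerSeries.coeff_coe]
    split_ifs with hk
    · symm
      rw [Nat.cast_eq_zero, Set.ncard_eq_zero (hfin _)]
      refine Set.eq_empty_iff_forall_notMem.2 ?_
      rintro y ⟨-, hy⟩
      have : 0 ≤ ∑ i, (y i : ℤ) := Finset.sum_nonneg fun _ _ => Int.natCast_nonneg _
      omega
    · simp only [degreeSeries, PowerSeries.coeff_mk, Set.indicator_apply, Pi.one_apply,
        Finset.sum_boole]
      rw [← Set.ncard_coe_finset]
      congr 2
      ext y
      simp only [Finset.coe_filter, mem_piAntidiag_univ, Set.mem_ofPred_eq, Set.mem_preimage,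
        ← Nat.cast_sum]
      constructor
      · rintro ⟨h, hy⟩
        exact ⟨hy, by omega⟩
      · rintro ⟨hy, h⟩
        exact ⟨by omega, hy⟩
  · intro φ hφ ψ hψ
    exact single_mul_ofPowerSeries_mem_range
      (degreeSeries_mem_of_polyhedral (hΔ.indicator_preimage_mem hm s)) _ hφ hψ
end
end

section
/- Let γ ∈ ℚ with γ ≥ 0, and let a, b ∈ ℤ. For each integer m ≥ 1 let s_m ∈ R = ℤ[U, U^{-1}] be the finite sum s_m = Σ U^{−m(aδ+b)}, the sum ranging over those δ ∈ ℚ with 0 ≤ δ < γ and m·δ ∈ ℤ (note that m(aδ+b) ∈ ℤ for such δ). Then there exists h ∈ R[T]_† with e_T(h) = Σ_{m≥1} s_m·T^m in R[[T]], and e_{T^{-1}}(h) is supported in the strictly positive powers of V; in the notation of the paper, lim_{T→∞} Σ_{m≥1} s_m·T^m exists and equals 0 = −χ([0,γ)). (This is the half-open interval case of the paper's polytope lemma, proved there by a direct geometric series computation.) -/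
noncomputable section

/-- The multiplicative subset `S_u` of `R[T]` generated by the polynomials
`1 - u^a · T^b` for `a ∈ ℤ` and `b ≥ 1`. -/
def Sdag {R : Type*} [CommRing R] (u : Rˣ) : Submonoid (Polynomial R) :=
  Submonoid.closure
    {p | ∃ (a : ℤ) (b : ℕ), 1 ≤ b ∧
      p = 1 - Polynomial.C ((u ^ a : Rˣ) : R) * Polynomial.X ^ b}

/-- The unit `U` of the Laurent polynomial ring `R = ℤ[U, U⁻¹]`. -/
def Uunit : (LaurentPolynomial ℤ)ˣ := (LaurentPolynomial.isUnit_T 1).unit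

open LaurentPolynomial in
theorem Uunit_zpow_val (n : ℤ) : ((Uunit ^ n : ℤ[T;T⁻¹]ˣ) : ℤ[T;T⁻¹]) = T n := by
  have h : ∀ k : ℕ, ((Uunit ^ k : ℤ[T;T⁻¹]ˣ) : ℤ[T;T⁻¹]) = T k := fun k => by
    simp [Uunit, T_pow]
  obtain ⟨k, rfl | rfl⟩ := n.eq_nat_or_neg
  · rw [zpow_natCast, h]
  · rw [zpow_neg, zpow_natCast, Units.inv_eq_of_mul_eq_one_right]
    rw [h, ← T_add, add_neg_cancel, T_zero]

theorem one_sub_C_T_mul_X_pow_mem_Sdag (k : ℤ) {n : ℕ} (hn : 1 ≤ n) :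
    1 - Polynomial.C (LaurentPolynomial.T k) * Polynomial.X ^ n ∈ Sdag Uunit :=
  Submonoid.subset_closure ⟨k, n, hn, by rw [Uunit_zpow_val]⟩

/-- If `(1 - u V⁻ⁿ) y` is supported in degrees `> N`, then `y` is supported in degrees
`> N + n`. -/
theorem LaurentSeries.coeff_eq_zero_of_one_sub_single_mul {R : Type*} [CommRing R] {u : R}
    (hu : IsUnit u) {n : ℕ} (hn : 1 ≤ n) {N : ℤ} {y : LaurentSeries R}
    (hy : ∀ k ≤ N, ((1 - HahnSeries.single (-(n : ℤ)) u) * y).coeff k = 0) :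
    ∀ k ≤ N + n, y.coeff k = 0 := by
  intro k hk
  by_cases h0 : y = 0
  · simp [h0]
  by_contra hne
  have hle : y.order ≤ k := HahnSeries.order_le_of_coeff_ne_zero hne
  have h1 := hy (y.order - n) (by omega)
  have h2 : y.coeff (y.order - n) = 0 :=
    HahnSeries.coeff_eq_zero_of_lt_order (by omega)
  have h3 : (HahnSeries.single (-(n : ℤ)) u * y).coeff (y.order - n) = u * y.coeff y.order := by
    rw [sub_eq_add_neg, add_comm, ← HahnSeries.coeff_single_mul_add (r := u) (x := y), add_comm]
  rw [sub_mul, one_mul, HahnSeries.coeff_sub, h2, h3, zero_sub, neg_eq_zero,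
    hu.mul_right_eq_zero] at h1
  exact h0 (HahnSeries.coeff_order_eq_zero.mp h1)

/-- A linear recurrence `c (m + q) = w * c m` makes the generating series of `c`, starting in
degree one, a rational function with denominator `1 - w X ^ q`. -/
theorem PowerSeries.one_sub_C_mul_X_pow_mul_mk {R : Type*} [CommRing R] (c : ℕ → R) (w : R)
    (q : ℕ) (hc : ∀ m, c (m + q) = w * c m) :
    (1 - C w * X ^ q) * (X * mk c) =
      ((∑ i ∈ Finset.range q, Polynomial.C (c i) * Polynomial.X ^ (i + 1) : Polynomial R) :
        PowerSeries R) := by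
  ext m
  rw [Polynomial.coeff_coe, Polynomial.finsetSum_coeff, mul_left_comm]
  cases m with
  | zero => simp
  | succ m =>
    rw [coeff_succ_X_mul, sub_mul, one_mul, mul_assoc, map_sub, coeff_C_mul, coeff_X_pow_mul']
    simp only [coeff_mk, Polynomial.coeff_C_mul_X_pow, add_left_inj, Finset.sum_ite_eq,
      Finset.mem_range]
    split_ifs with h₁ h₂ h₂
    · omega
    · rw [← hc, Nat.sub_add_cancel h₁, sub_self]
    · simp
    · omega

/-- The sum of `U ^ (-(a j + b (m + 1)))` over the lattice points `m γ ≤ j < (m + 1) γ`. -/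
def sliceSum (γ : ℚ) (a b : ℤ) (m : ℕ) : LaurentPolynomial ℤ :=
  ∑ j ∈ Finset.Ico ⌈(m : ℚ) * γ⌉ ⌈((m + 1 : ℕ) : ℚ) * γ⌉,
    LaurentPolynomial.T (-(a * j + b * ((m + 1 : ℕ) : ℤ)))

theorem sliceSum_add_den (γ : ℚ) (a b : ℤ) (m : ℕ) :
    sliceSum γ a b (m + γ.den) =
      LaurentPolynomial.T (-(a * γ.num + b * γ.den)) * sliceSum γ a b m := by
  have h : ∀ k : ℕ, ⌈((k + γ.den : ℕ) : ℚ) * γ⌉ = ⌈(k : ℚ) * γ⌉ + γ.num := fun k => by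
    rw [Nat.cast_add, add_mul, Rat.den_mul_eq_num, Int.ceil_add_intCast]
  rw [sliceSum, sliceSum, add_right_comm, h, h, ← Finset.map_add_right_Ico, Finset.sum_map,
    Finset.mul_sum]
  refine Finset.sum_congr rfl fun j _ => ?_
  rw [← LaurentPolynomial.T_add]
  congr 1
  simp only [addRightEmbedding_apply]
  push_cast
  ring

theorem one_sub_C_T_mul_X_mul_mk_eq (γ : ℚ) (hγ : 0 ≤ γ) (a b : ℤ) :
    (1 - PowerSeries.C (LaurentPolynomial.T (-b)) * PowerSeries.X) *
      PowerSeries.mk (fun m =>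
          if 1 ≤ m then
            ∑ j ∈ Finset.Ico (0 : ℤ) ⌈(m : ℚ) * γ⌉,
              LaurentPolynomial.T (-(a * j + b * (m : ℤ)))
          else 0) = PowerSeries.X * PowerSeries.mk (sliceSum γ a b) := by
  ext1 m
  rw [sub_mul, one_mul, mul_assoc, map_sub, PowerSeries.coeff_C_mul]
  cases m with
  | zero => simp
  | succ m =>
    simp only [PowerSeries.coeff_succ_X_mul, PowerSeries.coeff_mk, Nat.le_add_left, if_true]
    have h : (if 1 ≤ m then ∑ j ∈ Finset.Ico (0 : ℤ) ⌈(m : ℚ) * γ⌉,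
        LaurentPolynomial.T (R := ℤ) (-(a * j + b * (m : ℤ))) else 0) =
        ∑ j ∈ Finset.Ico (0 : ℤ) ⌈(m : ℚ) * γ⌉,
          LaurentPolynomial.T (-(a * j + b * (m : ℤ))) := by
      cases m <;> simp
    rw [h, Finset.mul_sum, sliceSum, sub_eq_iff_eq_add',
      ← Finset.Ico_union_Ico_eq_Ico (Int.ceil_nonneg (by positivity : 0 ≤ (m : ℚ) * γ))
        (Int.ceil_mono (by gcongr; omega : (m : ℚ) * γ ≤ ((m + 1 : ℕ) : ℚ) * γ)),
      Finset.sum_union (Finset.Ico_disjoint_Ico_consecutive _ _ _)]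
    congr 1
    refine Finset.sum_congr rfl fun j _ => ?_
    rw [← LaurentPolynomial.T_add]
    congr 1
    push_cast
    ring

/-- Let `γ ∈ ℚ`, `γ ≥ 0`, and `a, b ∈ ℤ`.  For each `m ≥ 1` let
`s_m = Σ U^(-m(aδ+b)) ∈ ℤ[U, U⁻¹]`, the sum ranging over the `δ ∈ ℚ` with
`0 ≤ δ < γ` and `m·δ ∈ ℤ` (equivalently, over `δ = j/m` with `j ∈ ℤ`,
`0 ≤ j < m·γ`, the summand being `U^(-(aj+bm))`).  Then there is `h ∈ R[T]_†`
with `e_T(h) = Σ_{m≥1} s_m T^m`, and `e_{T⁻¹}(h)` is supported in the strictly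
positive powers of `V`; in particular `lim_{T→∞} Σ_{m≥1} s_m T^m = 0 = -χ([0,γ))`. -/
theorem halfOpenInterval_zeta_limit
    (γ : ℚ) (hγ : 0 ≤ γ) (a b : ℤ)
    (eT : Localization (Sdag Uunit) →+* PowerSeries (LaurentPolynomial ℤ))
    (heT : ∀ p : Polynomial (LaurentPolynomial ℤ),
      eT (algebraMap (Polynomial (LaurentPolynomial ℤ)) (Localization (Sdag Uunit)) p)
        = (p : PowerSeries (LaurentPolynomial ℤ)))
    (eTinv : Localization (Sdag Uunit) →+* LaurentSeries (LaurentPolynomial ℤ))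
    (heTinv : ∀ p : Polynomial (LaurentPolynomial ℤ),
      eTinv (algebraMap (Polynomial (LaurentPolynomial ℤ)) (Localization (Sdag Uunit)) p)
        = p.eval₂ (HahnSeries.C : LaurentPolynomial ℤ →+* LaurentSeries (LaurentPolynomial ℤ))
            (HahnSeries.single (-1 : ℤ) 1)) :
    ∃ h : Localization (Sdag Uunit),
      eT h = PowerSeries.mk (fun m =>
          if 1 ≤ m then
            ∑ j ∈ Finset.Ico (0 : ℤ) ⌈(m : ℚ) * γ⌉,
              LaurentPolynomial.T (-(a * j + b * (m : ℤ)))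
          else 0) ∧
      ∀ k : ℤ, k ≤ 0 → (eTinv h).coeff k = 0 := by
  set w : LaurentPolynomial ℤ := LaurentPolynomial.T (-(a * γ.num + b * γ.den))
  set v : LaurentPolynomial ℤ := LaurentPolynomial.T (-b)
  have hq : 1 ≤ γ.den := γ.den_pos
  let D₁ : Polynomial (LaurentPolynomial ℤ) := 1 - Polynomial.C v * Polynomial.X ^ 1
  let D₂ : Polynomial (LaurentPolynomial ℤ) := 1 - Polynomial.C w * Polynomial.X ^ γ.den
  let P : Polynomial (LaurentPolynomial ℤ) :=
    ∑ i ∈ Finset.range γ.den, Polynomial.C (sliceSum γ a b i) * Polynomial.X ^ (i + 1)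
  let D : Sdag Uunit := ⟨D₂ * D₁, mul_mem (one_sub_C_T_mul_X_pow_mem_Sdag _ hq)
    (one_sub_C_T_mul_X_pow_mem_Sdag _ le_rfl)⟩
  have hD : algebraMap _ (Localization (Sdag Uunit)) (D₂ * D₁) * Localization.mk P D =
      algebraMap _ _ P := by
    rw [mul_comm, Localization.mk_eq_mk']
    exact IsLocalization.mk'_spec _ P D
  refine ⟨Localization.mk P D, ?_, ?_⟩
  · have hunit : IsUnit ((D₂ * D₁ : Polynomial (LaurentPolynomial ℤ)) :
        PowerSeries (LaurentPolynomial ℤ)) := by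
      rw [PowerSeries.isUnit_iff_constantCoeff]
      simp [D₁, D₂, (Nat.pos_of_ne_zero γ.den_nz).ne']
    refine hunit.mul_left_cancel ?_
    have h := congrArg eT hD
    rw [map_mul, heT, heT] at h
    rw [h]
    simp only [D₁, D₂, Polynomial.coe_mul, Polynomial.coe_sub, Polynomial.coe_one,
      Polynomial.coe_C, Polynomial.coe_pow, Polynomial.coe_X, pow_one]
    rw [mul_assoc, one_sub_C_T_mul_X_mul_mk_eq γ hγ a b,
      PowerSeries.one_sub_C_mul_X_pow_mul_mk _ _ _ (sliceSum_add_den γ a b)]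
  · have hmon : ∀ (c : LaurentPolynomial ℤ) (n : ℕ),
        (Polynomial.C c * Polynomial.X ^ n).eval₂
          (HahnSeries.C : LaurentPolynomial ℤ →+* LaurentSeries (LaurentPolynomial ℤ))
            (HahnSeries.single (-1 : ℤ) 1) = HahnSeries.single (-(n : ℤ)) c := fun c n => by
      simp [HahnSeries.single_pow, HahnSeries.C_apply, HahnSeries.single_mul_single]
    have h := congrArg eTinv hD
    rw [map_mul, heTinv, heTinv, Polynomial.eval₂_mul, mul_assoc] at h
    simp only [D₁, D₂, P, Polynomial.eval₂_sub, Polynomial.eval₂_one, hmon,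
      Polynomial.eval₂_finsetSum] at h
    have hP : ∀ k ≤ -(γ.den : ℤ) - 1, (∑ i ∈ Finset.range γ.den, HahnSeries.single
        (-((i + 1 : ℕ) : ℤ)) (sliceSum γ a b i)).coeff k = 0 := fun k hk => by
      rw [HahnSeries.coeff_sum]
      refine Finset.sum_eq_zero fun i hi => HahnSeries.coeff_single_of_ne ?_
      have := Finset.mem_range.mp hi
      omega
    rw [← h] at hP
    have h₁ := LaurentSeries.coeff_eq_zero_of_one_sub_single_mul
      (LaurentPolynomial.isUnit_T _) hq hP
    have h₂ := LaurentSeries.coeff_eq_zero_of_one_sub_single_mul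
      (LaurentPolynomial.isUnit_T _) le_rfl h₁
    exact fun k hk => h₂ k (by push_cast; omega)
end
end

section
/- Let q ∈ ℚ and a, b ∈ ℤ. For each integer m ≥ 1 set s_m = U^{−m(aq+b)} ∈ R = ℤ[U, U^{-1}] if m·q ∈ ℤ (in which case m(aq+b) ∈ ℤ), and s_m = 0 otherwise. Then there exists h ∈ R[T]_† with e_T(h) = Σ_{m≥1} s_m·T^m in R[[T]], e_{T^{-1}}(h) lies in R[[V]], and the constant term of e_{T^{-1}}(h) equals −1; in the notation of the paper, lim_{T→∞} Σ_{m≥1} s_m·T^m exists and equals −1 = −χ({q}). (This is the singleton case of the paper's polytope lemma, proved there by a direct geometric series computation.) -/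
noncomputable section

theorem Uunit_zpow (c : ℤ) :
    ((Uunit ^ c : (LaurentPolynomial ℤ)ˣ) : LaurentPolynomial ℤ) = LaurentPolynomial.T c := by
  have key : ∀ k : ℕ, ((Uunit ^ k : (LaurentPolynomial ℤ)ˣ) : LaurentPolynomial ℤ)
      = LaurentPolynomial.T k := by
    intro k
    simp [Uunit, LaurentPolynomial.T_pow]
  obtain ⟨k, rfl | rfl⟩ := c.eq_nat_or_neg
  · rw [zpow_natCast, key]
  · rw [zpow_neg, zpow_natCast, Units.inv_eq_of_mul_eq_one_right]
    rw [key, ← LaurentPolynomial.T_add, add_neg_cancel, LaurentPolynomial.T_zero]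

theorem PowerSeries.mk_mul_one_sub_C_mul_X_pow {R : Type*} [CommRing R] {n : ℕ} (hn : 0 < n)
    (w : R) (s : ℕ → R) (hdvd : ∀ k, 1 ≤ k → s (n * k) = w ^ k)
    (hndvd : ∀ m, ¬ n ∣ m → s m = 0) :
    PowerSeries.mk (fun m => if 1 ≤ m then s m else 0)
        * (1 - PowerSeries.C w * PowerSeries.X ^ n)
      = PowerSeries.C w * PowerSeries.X ^ n := by
  ext m
  rw [mul_sub, mul_one, mul_left_comm, map_sub, PowerSeries.coeff_C_mul, PowerSeries.coeff_C_mul,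
    PowerSeries.coeff_mul_X_pow', PowerSeries.coeff_X_pow, PowerSeries.coeff_mk,
    PowerSeries.coeff_mk]
  by_cases hm : n ∣ m
  · obtain ⟨k, rfl⟩ := hm
    rcases k with _ | _ | k
    · simp [hn.ne, hn.ne']
    · have := hdvd 1 le_rfl
      simp only [mul_one, pow_one] at this
      simp [this, Nat.one_le_iff_ne_zero, hn.ne']
    · have h1 := hdvd (k + 1 + 1) (by lia)
      have h2 := hdvd (k + 1) (by lia)
      have h3 : n * (k + 1 + 1) - n = n * (k + 1) := by
        rw [mul_add n (k + 1), mul_one, Nat.add_sub_cancel]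
      have h4 : n * (k + 1 + 1) ≠ n := by
        intro h
        have := Nat.eq_of_mul_eq_mul_left hn (h.trans (mul_one n).symm)
        lia
      have h5 : 1 ≤ n * (k + 1 + 1) := Nat.mul_pos hn (Nat.succ_pos (k + 1))
      have h6 : 1 ≤ n * (k + 1) := Nat.mul_pos hn (Nat.succ_pos k)
      rw [h3, h1, h2, if_pos h5,
        if_pos (Nat.le_mul_of_pos_right n (Nat.succ_pos (k + 1))),
        if_pos h6, if_neg h4, pow_succ' w (k + 1)]
      ring
  · have h1 : m ≠ n := by
      rintro rfl
      exact hm dvd_rfl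
    rw [hndvd m hm, if_neg h1]
    by_cases h2 : n ≤ m
    · have h3 : ¬ n ∣ m - n := fun h => hm ((Nat.dvd_sub_iff_left h2 dvd_rfl).mp h)
      simp [hndvd (m - n) h3]
    · simp [h2]

theorem Rat.exists_natCast_mul_eq_intCast_iff (q : ℚ) (m : ℕ) :
    (∃ z : ℤ, (m : ℚ) * q = z) ↔ q.den ∣ m := by
  constructor
  · rintro ⟨z, hz⟩
    have h : (m : ℤ) * q.num = z * q.den := by
      have h1 := q.mul_den_eq_num
      have : (m : ℚ) * q.num = z * q.den := by rw [← h1, ← hz]; ring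
      exact_mod_cast this
    have h2 : (q.den : ℤ) ∣ m * q.num := ⟨z, by rw [h, mul_comm]⟩
    have h3 : IsCoprime (q.den : ℤ) q.num := (Rat.isCoprime_num_den q).symm
    exact_mod_cast h3.dvd_of_dvd_mul_right h2
  · rintro ⟨k, rfl⟩
    refine ⟨k * q.num, ?_⟩
    push_cast
    rw [← q.mul_den_eq_num]
    ring

theorem LaurentSeries.eq_neg_ofPowerSeries_invOfUnit {R : Type*} [CommRing R] (n : ℕ) (w : Rˣ)
    (g : LaurentSeries R)
    (hg : g * (1 - HahnSeries.single (-(n : ℤ)) (w : R)) = HahnSeries.single (-(n : ℤ)) (w : R))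
    (hn : 0 < n) :
    g = HahnSeries.ofPowerSeries ℤ R (-PowerSeries.invOfUnit
      (1 - PowerSeries.C ((w⁻¹ : Rˣ) : R) * PowerSeries.X ^ n) 1) := by
  set P : PowerSeries R := 1 - PowerSeries.C ((w⁻¹ : Rˣ) : R) * PowerSeries.X ^ n with hP
  have hinv : P * PowerSeries.invOfUnit P 1 = 1 :=
    PowerSeries.mul_invOfUnit P 1 (by simp [hP, hn.ne'])
  have hPimg : HahnSeries.ofPowerSeries ℤ R P
      = 1 - HahnSeries.single (n : ℤ) ((w⁻¹ : Rˣ) : R) := by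
    rw [hP, map_sub, map_one, map_mul, HahnSeries.ofPowerSeries_C, HahnSeries.ofPowerSeries_X_pow,
      HahnSeries.C_apply, HahnSeries.single_mul_single, zero_add, mul_one]
  have hunit : HahnSeries.single (-(n : ℤ)) (w : R)
      * HahnSeries.single (n : ℤ) ((w⁻¹ : Rˣ) : R) = 1 := by
    rw [HahnSeries.single_mul_single, neg_add_cancel, Units.mul_inv]
    rfl
  have hgP : g * HahnSeries.ofPowerSeries ℤ R P = -1 := by
    rw [hPimg]
    linear_combination (-HahnSeries.single (n : ℤ) ((w⁻¹ : Rˣ) : R)) * hg - (g + 1) * hunit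
  have himg : HahnSeries.ofPowerSeries ℤ R P
      * HahnSeries.ofPowerSeries ℤ R (PowerSeries.invOfUnit P 1) = 1 := by
    rw [← map_mul, hinv, map_one]
  rw [map_neg]
  linear_combination
    HahnSeries.ofPowerSeries ℤ R (PowerSeries.invOfUnit P 1) * hgP - g * himg

/-- Let `q ∈ ℚ` and `a, b ∈ ℤ`.  For each `m ≥ 1` set `s_m = U^(-m(aq+b)) ∈ ℤ[U, U⁻¹]`
if `m·q ∈ ℤ` (so that `m(aq+b) = a·(mq) + bm ∈ ℤ`) and `s_m = 0` otherwise.  Then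
there is `h ∈ R[T]_†` with `e_T(h) = Σ_{m≥1} s_m T^m`, `e_{T⁻¹}(h)` lies in
`R[[V]]`, and the constant term of `e_{T⁻¹}(h)` is `-1`; in particular
`lim_{T→∞} Σ_{m≥1} s_m T^m = -1 = -χ({q})`. -/
theorem singleton_zeta_limit
    (q : ℚ) (a b : ℤ) (s : ℕ → LaurentPolynomial ℤ)
    (hs1 : ∀ (m : ℕ) (z : ℤ), 1 ≤ m → (m : ℚ) * q = (z : ℚ) →
      s m = LaurentPolynomial.T (-(a * z + b * (m : ℤ))))
    (hs2 : ∀ m : ℕ, 1 ≤ m → (¬ ∃ z : ℤ, (m : ℚ) * q = (z : ℚ)) → s m = 0)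
    (eT : Localization (Sdag Uunit) →+* PowerSeries (LaurentPolynomial ℤ))
    (heT : ∀ p : Polynomial (LaurentPolynomial ℤ),
      eT (algebraMap (Polynomial (LaurentPolynomial ℤ)) (Localization (Sdag Uunit)) p)
        = (p : PowerSeries (LaurentPolynomial ℤ)))
    (eTinv : Localization (Sdag Uunit) →+* LaurentSeries (LaurentPolynomial ℤ))
    (heTinv : ∀ p : Polynomial (LaurentPolynomial ℤ),
      eTinv (algebraMap (Polynomial (LaurentPolynomial ℤ)) (Localization (Sdag Uunit)) p)
        = p.eval₂ (HahnSeries.C : LaurentPolynomial ℤ →+* LaurentSeries (LaurentPolynomial ℤ))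
            (HahnSeries.single (-1 : ℤ) 1)) :
    ∃ h : Localization (Sdag Uunit),
      eT h = PowerSeries.mk (fun m => if 1 ≤ m then s m else 0) ∧
      (∀ k : ℤ, k < 0 → (eTinv h).coeff k = 0) ∧
      (eTinv h).coeff 0 = -1 := by
  set c : ℤ := -(a * q.num + b * q.den) with hc
  set w : (LaurentPolynomial ℤ)ˣ := Uunit ^ c with hw
  have hn : 0 < q.den := q.den_pos
  set N : Polynomial (LaurentPolynomial ℤ) :=
    Polynomial.C (w : LaurentPolynomial ℤ) * Polynomial.X ^ q.den with hN
  have hmem : 1 - N ∈ Sdag Uunit := Submonoid.subset_closure ⟨c, q.den, hn, rfl⟩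
  have hunit : IsUnit (algebraMap _ (Localization (Sdag Uunit)) (1 - N)) :=
    IsLocalization.map_units _ (⟨1 - N, hmem⟩ : Sdag Uunit)
  obtain ⟨e, he⟩ := hunit.exists_left_inv
  have hmul : algebraMap _ (Localization (Sdag Uunit)) N * e
      * algebraMap _ (Localization (Sdag Uunit)) (1 - N) = algebraMap _ _ N := by
    rw [mul_assoc, he, mul_one]
  refine ⟨algebraMap _ _ N * e, ?_, ?_⟩
  · have hden := hunit.map eT
    have h1 := congrArg eT hmul
    rw [map_mul, heT, heT] at h1
    rw [heT] at hden
    apply hden.mul_right_cancel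
    rw [h1]
    have h2 := PowerSeries.mk_mul_one_sub_C_mul_X_pow hn (w : LaurentPolynomial ℤ)
      (fun m => if 1 ≤ m then s m else 0) ?_ ?_
    · simpa [hN, ← ite_and] using h2.symm
    · intro k hk
      have hpos : 1 ≤ q.den * k := Nat.mul_pos hn hk
      have hz : ((q.den * k : ℕ) : ℚ) * q = ((k * q.num : ℤ) : ℚ) := by
        push_cast
        rw [← q.mul_den_eq_num]
        ring
      rw [if_pos hpos, hs1 _ _ hpos hz, hw, Uunit_zpow, LaurentPolynomial.T_pow, hc]
      congr 1
      push_cast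
      ring
    · intro m hm
      split_ifs with h
      · exact hs2 m h (mt (Rat.exists_natCast_mul_eq_intCast_iff q m).mp hm)
      · rfl
  · have h1 := congrArg eTinv hmul
    have hNimg : eTinv (algebraMap _ _ N)
        = HahnSeries.single (-(q.den : ℤ)) (w : LaurentPolynomial ℤ) := by
      rw [heTinv, hN]
      simp [HahnSeries.C_apply, HahnSeries.single_pow, HahnSeries.single_mul_single]
    rw [map_mul, map_sub, map_one, map_sub, map_one, hNimg] at h1
    rw [LaurentSeries.eq_neg_ofPowerSeries_invOfUnit q.den w _ h1 hn]
    constructor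
    · intro k hk
      rw [PowerSeries.coeff_coe, if_pos hk]
    · rw [PowerSeries.coeff_coe]
      simp
end
end
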